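/- arXiv:2107.03523 — 5 statements merged into one kernel-verified Lean document; each statement's English description precedes it below -/
import Mathlib

section
/- Let n, m, k and the data (L^0,…,L^k, y) be as in the general sequence model, set R = ∑_{i=0}^k ∑_{j=0}^{i} j·L^i(j), and assume 2m − R ≥ ∑_{i=0}^k (i+1)·L^i(i+1). Let λ be the unique positive real solving ∑_{i=0}^{k} (λ f_{i−1}(λ)/f_i(λ))·L^i(i+1) = 2m − R. Let {Z_j : j ∈ [n]} be independent random variables where Z_j is distributed as the truncated Poisson Po_{≥y_2(j)}(λ) if y_2(j) = y_1(j)+1, and Z_j = y_2(j) deterministically if y_2(j) ≤ y_1(j); given (Z_j)_{j∈[n]}, let x′ be chosen uniformly among all finite sequences over [n] in which each element j appears exactly Z_j times. Let x be chosen uniformly at random from (S_{n,2m}^{L^0,…,L^k}, y). Then, conditioned on the length of x′ being 2m, the sequence x′ has the same distribution as x. -/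
open Filter
open scoped Classical

/-- `fTail ℓ x = e^x − ∑_{i=0}^{ℓ−1} x^i/i!` (so `fTail 0 x = e^x`, which also serves
as `f_{−1}` via truncated subtraction). -/
noncomputable def fTail (ℓ : ℕ) (x : ℝ) : ℝ :=
  Real.exp x - ∑ i ∈ Finset.range ℓ, x ^ i / (Nat.factorial i : ℝ)

/-- The number of occurrences of `v` in the sequence `x ∈ [n]^m`. -/
noncomputable def occCount (n m : ℕ) (x : Fin m → Fin n) (v : Fin n) : ℕ :=
  (Finset.univ.filter (fun j => x j = v)).card

/-- The set `(S_{n,2m}^{L^0,…,L^k}, y)` of admissible sequences: `v` appears exactly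
`y₂(v)` times if `y₂(v) ≤ y₁(v)`, and at least `y₂(v)` times if `y₂(v) = y₁(v)+1`. -/
def SeqSet (n m : ℕ) (y : Fin n → ℕ × ℕ) : Set (Fin (2 * m) → Fin n) :=
  {x | ∀ v : Fin n,
    ((y v).2 ≤ (y v).1 → occCount n (2 * m) x v = (y v).2) ∧
    ((y v).2 = (y v).1 + 1 → (y v).2 ≤ occCount n (2 * m) x v)}

/-- `Pr(Z_v = t)`: a point mass at `y₂(v)` if `y₂(v) ≤ y₁(v)`, and the truncated
Poisson `Po_{≥y₂(v)}(λ)` if `y₂(v) = y₁(v)+1`. -/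
noncomputable def zProb (n : ℕ) (y : Fin n → ℕ × ℕ) (lam : ℝ) (v : Fin n) (t : ℕ) : ℝ :=
  if (y v).2 ≤ (y v).1 then (if t = (y v).2 then 1 else 0)
  else (if (y v).2 ≤ t then lam ^ t / ((Nat.factorial t : ℝ) * fTail (y v).2 lam) else 0)

theorem fTail_pos (ℓ : ℕ) {x : ℝ} (hx : 0 < x) : 0 < fTail ℓ x := by
  have h := Real.sum_le_exp_of_nonneg hx.le (ℓ + 1)
  rw [Finset.sum_range_succ] at h
  have h' : 0 < x ^ ℓ / (Nat.factorial ℓ : ℝ) := by positivity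
  unfold fTail
  linarith

theorem occCount_cons (n N : ℕ) (a : Fin n) (x : Fin N → Fin n) (v : Fin n) :
    occCount n (N + 1) (Fin.cons a x) v = (if a = v then 1 else 0) + occCount n N x v := by
  unfold occCount
  rw [Finset.card_filter, Finset.card_filter, Fin.sum_univ_succ]
  simp

theorem sum_occCount (n N : ℕ) (x : Fin N → Fin n) : ∑ v, occCount n N x v = N := by
  unfold occCount
  rw [← Finset.card_eq_sum_card_fiberwise (fun _ _ => Finset.mem_coe.2 (Finset.mem_univ _))]
  simp

/-- The number of sequences with occurrence vector `d`, times `∏ v, (d v)!`, is the factorial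
of the length. -/
theorem card_occCount_eq_mul_prod_factorial (n N : ℕ) (d : Fin n → ℕ) (hd : ∑ v, d v = N) :
    (Finset.univ.filter fun x : Fin N → Fin n => occCount n N x = d).card *
      ∏ v, (d v).factorial = N.factorial := by
  induction N generalizing d with
  | zero =>
    have h0 : d = 0 := by
      funext v
      exact Finset.sum_eq_zero_iff.1 hd v (Finset.mem_univ v)
    subst h0
    have h (x : Fin 0 → Fin n) : occCount n 0 x = 0 := by
      funext v
      simp [occCount]
    simp [h]
  | succ N ih =>
    rw [Finset.card_filter,
      ← (Fin.consEquiv fun _ : Fin (N + 1) => Fin n).sum_comp, Fintype.sum_prod_type,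
      Finset.sum_mul, Nat.factorial_succ,
      show (N + 1) * N.factorial = (∑ v, d v) * N.factorial by rw [hd], Finset.sum_mul]
    refine Finset.sum_congr rfl fun a _ => ?_
    simp only [Fin.consEquiv, Equiv.coe_fn_mk]
    rcases Nat.eq_zero_or_pos (d a) with ha | ha
    · have h (x : Fin N → Fin n) : occCount n (N + 1) (Fin.cons a x) ≠ d := by
        intro h
        have := congrFun h a
        rw [occCount_cons, ha] at this
        simp at this
      simp [h, ha]
    · set e : Fin n → ℕ := Function.update d a (d a - 1) with he
      have hde (v : Fin n) : d v = (if a = v then 1 else 0) + e v := by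
        by_cases hv : a = v
        · subst hv
          simp [he]
          omega
        · simp [he, hv, Function.update_of_ne (Ne.symm hv)]
      have hiff (x : Fin N → Fin n) :
          occCount n (N + 1) (Fin.cons a x) = d ↔ occCount n N x = e := by
        constructor
        · intro h
          funext v
          have h1 := congrFun h v
          rw [occCount_cons, hde v] at h1
          exact Nat.add_left_cancel h1
        · intro h
          funext v
          rw [occCount_cons, hde v, h]
      have hsum : ∑ v, e v = N := by
        have h1 : ∑ v, d v = ∑ v, ((if a = v then 1 else 0) + e v) :=
          Finset.sum_congr rfl fun v _ => hde v
        rw [Finset.sum_add_distrib, hd] at h1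
        simp at h1
        omega
      have hprod : ∏ v, (d v).factorial = d a * ∏ v, (e v).factorial := by
        rw [← Finset.mul_prod_erase _ _ (Finset.mem_univ a),
          ← Finset.mul_prod_erase _ (fun v => (e v).factorial) (Finset.mem_univ a), ← mul_assoc]
        congr 1
        · simp [he, Nat.mul_factorial_pred ha.ne']
        · refine Finset.prod_congr rfl fun v hv => ?_
          rw [he, Function.update_of_ne (Finset.ne_of_mem_erase hv)]
      simp only [hiff]
      rw [← Finset.card_filter, hprod, mul_left_comm, ih e hsum]

theorem zProb_mul_factorial (n : ℕ) (y : Fin n → ℕ × ℕ)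
    (hy : ∀ v : Fin n, (y v).2 ≤ (y v).1 + 1) {lam : ℝ} (hlam : 0 < lam) (v : Fin n) (t : ℕ) :
    zProb n y lam v t * (t.factorial : ℝ) =
      if ((y v).2 ≤ (y v).1 → t = (y v).2) ∧ ((y v).2 = (y v).1 + 1 → (y v).2 ≤ t) then
        (if (y v).2 ≤ (y v).1 then ((y v).2.factorial : ℝ) / lam ^ (y v).2
          else 1 / fTail (y v).2 lam) * lam ^ t
      else 0 := by
  have hf := (fTail_pos (y v).2 hlam).ne'
  have ht : (t.factorial : ℝ) ≠ 0 := by positivity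
  unfold zProb
  by_cases h : (y v).2 ≤ (y v).1
  · have h' : (y v).2 ≠ (y v).1 + 1 := by omega
    by_cases h2 : t = (y v).2
    · subst h2
      simp only [if_pos h, h', implies_true, false_imp_iff, if_true, and_true]
      field_simp
    · simp [h, h2]
  · have h' : (y v).2 = (y v).1 + 1 := by have := hy v; omega
    by_cases h2 : (y v).2 ≤ t
    · simp only [h, h2, if_false, false_imp_iff, implies_true, and_self, if_true]
      field_simp
    · rw [if_neg h, if_neg h2, if_neg fun hc => h2 (hc.2 h'), zero_mul]

/-- **Equivalence of the sequence model and the conditioned Poisson model.**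
Let `x` be uniform on `(S_{n,2m}^{L^0,…,L^k}, y)` and let `x′` be generated by first
sampling independent multiplicities `Z_v` (`Z_v = y₂(v)` deterministically if
`y₂(v) ≤ y₁(v)`, and `Z_v ~ Po_{≥y₂(v)}(λ)` if `y₂(v) = y₁(v)+1`), then choosing a
uniform sequence with these multiplicities.  Assume
`2m − R ≥ ∑ (i+1)L^i(i+1)` and let `λ > 0` satisfy
`∑_i (λ f_{i−1}(λ)/f_i(λ))·L^i(i+1) = 2m − R`.  Then, conditioned on `x′` having
length `2m`, `x′` has the same distribution as `x`: for every `w ∈ [n]^{2m}`,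
`Pr(x = w)` equals `Pr(Z = deg_w)·(∏_v (deg_w v)!)/(2m)!` divided by `Pr(len = 2m)`. -/
theorem stmt_6 (n m k : ℕ) (hn : 1 ≤ n) (hm : 1 ≤ m)
    (L : ℕ → ℕ → ℕ) (y : Fin n → ℕ × ℕ)
    (hy1 : ∀ v : Fin n, (y v).1 ≤ k)
    (hy2 : ∀ v : Fin n, (y v).2 ≤ (y v).1 + 1)
    (hLy : ∀ i ≤ k, ∀ j ≤ i + 1, Nat.card {v : Fin n // y v = (i, j)} = L i j)
    (hLsum : ∑ i ∈ Finset.range (k + 1), ∑ j ∈ Finset.range (i + 2), L i j = n)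
    (hcond : (∑ i ∈ Finset.range (k + 1), ((i : ℝ) + 1) * (L i (i + 1) : ℝ)) ≤
      2 * (m : ℝ) -
        (∑ i ∈ Finset.range (k + 1), ∑ j ∈ Finset.range (i + 1), (j : ℝ) * (L i j : ℝ)))
    (lam : ℝ) (hlam : 0 < lam)
    (hlameq : ∑ i ∈ Finset.range (k + 1),
        (lam * fTail (i - 1) lam / fTail i lam) * (L i (i + 1) : ℝ) =
      2 * (m : ℝ) -
        (∑ i ∈ Finset.range (k + 1), ∑ j ∈ Finset.range (i + 1), (j : ℝ) * (L i j : ℝ))) :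
    ∀ w : Fin (2 * m) → Fin n,
      (if w ∈ SeqSet n m y then (1 : ℝ) / (Nat.card ↥(SeqSet n m y) : ℝ) else 0) =
      ((∏ v : Fin n, zProb n y lam v (occCount n (2 * m) w v)) *
          (∏ v : Fin n, (Nat.factorial (occCount n (2 * m) w v) : ℝ)) /
          (Nat.factorial (2 * m) : ℝ)) /
        (∑' d : Fin n → ℕ,
          if (∑ v : Fin n, d v) = 2 * m then ∏ v : Fin n, zProb n y lam v (d v) else 0) := by
  intro w
  set c : Fin n → ℝ := fun v => if (y v).2 ≤ (y v).1 then
    ((y v).2.factorial : ℝ) / lam ^ (y v).2 else 1 / fTail (y v).2 lam with hc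
  set K : ℝ := (∏ v, c v) * lam ^ (2 * m)
  have hK0 : K ≠ 0 := by
    refine mul_ne_zero (Finset.prod_ne_zero_iff.2 fun v _ => ?_) (pow_ne_zero _ hlam.ne')
    have := fTail_pos (y v).2 hlam
    simp only [hc]
    split_ifs <;> positivity
  have hweight (x : Fin (2 * m) → Fin n) :
      (∏ v, zProb n y lam v (occCount n (2 * m) x v)) * ∏ v, ((occCount n (2 * m) x v).factorial : ℝ) =
        if x ∈ SeqSet n m y then K else 0 := by
    rw [← Finset.prod_mul_distrib]
    simp only [zProb_mul_factorial n y hy2 hlam]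
    split_ifs with hx
    · rw [Finset.prod_congr rfl fun v _ => if_pos (hx v), Finset.prod_mul_distrib,
        Finset.prod_pow_eq_pow_sum, sum_occCount]
    · obtain ⟨v, hv⟩ := not_forall.1 hx
      exact Finset.prod_eq_zero (Finset.mem_univ v) (if_neg hv)
  have htsum : (∑' d : Fin n → ℕ,
      if (∑ v, d v) = 2 * m then ∏ v, zProb n y lam v (d v) else 0) * ((2 * m).factorial : ℝ) =
        Nat.card (SeqSet n m y) * K := by
    have hmem (d : Fin n → ℕ) : d ∈ Finset.univ.piAntidiag (2 * m) ↔ ∑ v, d v = 2 * m := by simp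
    rw [tsum_eq_sum (s := Finset.univ.piAntidiag (2 * m)) fun d hd => if_neg (mt (hmem d).2 hd)]
    trans ∑ x : Fin (2 * m) → Fin n, if x ∈ SeqSet n m y then K else 0
    · rw [← Finset.sum_fiberwise_of_maps_to (g := occCount n (2 * m))
        (t := Finset.univ.piAntidiag (2 * m)) fun x _ => (hmem _).2 (sum_occCount n (2 * m) x),
        Finset.sum_mul]
      refine Finset.sum_congr rfl fun d hd => ?_
      have hd' := (hmem d).1 hd
      rw [if_pos hd', ← card_occCount_eq_mul_prod_factorial n (2 * m) d hd']
      have hconst : ∀ x ∈ Finset.univ.filter fun x : Fin (2 * m) → Fin n => occCount n (2 * m) x = d,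
          (if x ∈ SeqSet n m y then K else 0) =
            (∏ v, zProb n y lam v (d v)) * ∏ v, ((d v).factorial : ℝ) := by
        intro x hx
        rw [← hweight x, (Finset.mem_filter.1 hx).2]
      rw [Finset.sum_congr rfl hconst, Finset.sum_const, nsmul_eq_mul]
      push_cast
      ring
    · rw [← Finset.sum_filter, Finset.sum_const, nsmul_eq_mul, Nat.card_eq_fintype_card,
        Fintype.card_subtype]
  rw [hweight w, div_div, mul_comm ((2 * m).factorial : ℝ), htsum]
  split_ifs with hw
  · rw [div_mul_cancel_right₀ hK0, one_div]
  · simp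
end

section
/- Fix an integer k ≥ 2 and constants c₂ ≥ c₁ > (k+1)/2, let m = m(n) satisfy c₁n ≤ m ≤ c₂n, and let G ~ G_{n,m}^{δ≥k+1,seq}. There exists a constant β = β(k,c₁,c₂) ∈ (0,1) such that with probability 1 − O(n^{−1/2}): (i) there is no set S ⊆ V(G) with |S| ≤ k^{400} that spans at least |S|+1 edges of G; and (ii) there is no set S ⊆ V(G) with k^{200} ≤ |S| ≤ βn that spans at least (1+10^{−10})|S| edges of G. -/
open Filter
open scoped Classical

/-- The number of edges of the multigraph `G_x`, `x ∈ [n]^{2M}`, spanned by the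
vertex set `S` (counted with multiplicity): the number of indices `j < M` with both
`x_{2j}` and `x_{2j+1}` in `S`. -/
noncomputable def spanCount (n M : ℕ) (x : Fin (2 * M) → Fin n)
    (S : Finset (Fin n)) : ℕ :=
  (Finset.univ.filter (fun j : Fin M =>
    x ⟨2 * (j : ℕ), by have := j.2; omega⟩ ∈ S ∧
    x ⟨2 * (j : ℕ) + 1, by have := j.2; omega⟩ ∈ S)).card

/-- The sequences in `[n]^N` in which every value occurs at least `d` times and whose entries
at the positions in `P` lie in `S`. -/
noncomputable def minOccOn (n N d : ℕ) (P : Finset (Fin N)) (S : Finset (Fin n)) :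
    Finset (Fin N → Fin n) :=
  Finset.univ.filter (fun x => (∀ v, d ≤ occCount n N x v) ∧ ∀ p ∈ P, x p ∈ S)

lemma mem_minOccOn {n N d : ℕ} {P : Finset (Fin N)} {S : Finset (Fin n)} {x : Fin N → Fin n} :
    x ∈ minOccOn n N d P S ↔ (∀ v, d ≤ occCount n N x v) ∧ ∀ p ∈ P, x p ∈ S := by
  simp [minOccOn]

lemma le_occCount_update {n N d : ℕ} {x : Fin N → Fin n} {p : Fin N}
    (hx : ∀ w, d ≤ occCount n N x w) (hp : d < occCount n N x (x p)) (u w : Fin n) :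
    d ≤ occCount n N (Function.update x p u) w := by
  by_cases hw : w = x p
  · subst hw
    have hsub : (Finset.univ.filter (fun j => x j = x p)).erase p ⊆
        Finset.univ.filter (fun j => Function.update x p u j = x p) := by
      intro j hj
      simp only [Finset.mem_erase, Finset.mem_filter, Finset.mem_univ, true_and] at hj ⊢
      rw [Function.update_of_ne hj.1]
      exact hj.2
    have h1 := Finset.card_le_card hsub
    rw [Finset.card_erase_of_mem (by simp)] at h1
    unfold occCount at hp ⊢
    omega
  · refine (hx w).trans (Finset.card_le_card fun j hj => ?_)
    simp only [Finset.mem_filter, Finset.mem_univ, true_and] at hj ⊢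
    have : j ≠ p := by
      rintro rfl
      exact hw hj.symm
    rw [Function.update_of_ne this]
    exact hj

lemma occCount_comp_equiv {n N : ℕ} (x : Fin N → Fin n) (e : Equiv.Perm (Fin N)) (v : Fin n) :
    occCount n N (x ∘ e) v = occCount n N x v := by
  unfold occCount
  exact Finset.card_equiv e (by simp)

/-- Overwriting an occurrence of `v` by an arbitrary value: on average over `minOccOn`, the value
`v` occurs at most `N / n + d` times outside `P`. -/
lemma sum_card_minOccOn_eq_le (n N d : ℕ) (P : Finset (Fin N)) (S : Finset (Fin n)) (v : Fin n) :
    n * ∑ p ∈ Pᶜ, ((minOccOn n N d P S).filter (fun x => x p = v)).card ≤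
      (N + n * d) * (minOccOn n N d P S).card := by
  set B := minOccOn n N d P S with hB
  have hsplit : ∀ p ∈ Pᶜ, (B.filter (fun x => x p = v)).card =
      (B.filter (fun x => x p = v ∧ d < occCount n N x v)).card +
      (B.filter (fun x => x p = v ∧ ¬ d < occCount n N x v)).card := by
    intro p _
    rw [← Finset.filter_filter, ← Finset.filter_filter, Finset.card_filter_add_card_filter_not]
  have hmany : n * ∑ p ∈ Pᶜ, (B.filter (fun x => x p = v ∧ d < occCount n N x v)).card ≤
      N * B.card := by
    rw [← Finset.card_sigma]
    have hcard : ∀ T : Finset (Σ _ : Fin N, (Fin N → Fin n)),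
        n * T.card = ((Finset.univ : Finset (Fin n)) ×ˢ T).card := by
      intro T; simp
    have hcard' : N * B.card = ((Finset.univ : Finset (Fin N)) ×ˢ B).card := by simp
    rw [hcard, hcard']
    refine Finset.card_le_card_of_injOn
      (fun z => (z.2.1, Function.update z.2.2 z.2.1 z.1)) ?_ ?_
    · rintro ⟨u, p, x⟩ hz
      simp only [Finset.coe_product, Set.mem_prod, Finset.mem_coe, Finset.mem_univ, true_and,
        Finset.mem_sigma, Finset.mem_filter, Finset.mem_compl] at hz ⊢
      obtain ⟨hp, hx, hv, ho⟩ := hz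
      rw [hB, mem_minOccOn] at hx ⊢
      refine ⟨fun w => le_occCount_update hx.1 (by rwa [hv]) u w, fun q hq => ?_⟩
      have : q ≠ p := by
        rintro rfl
        exact hp hq
      rw [Function.update_of_ne this]
      exact hx.2 q hq
    · rintro ⟨u, p, x⟩ hz ⟨u', p', x'⟩ hz' h
      simp only [Finset.coe_product, Set.mem_prod, Finset.mem_coe, Finset.mem_univ, true_and,
        Finset.mem_sigma, Finset.mem_filter, Finset.mem_compl] at hz hz'
      simp only [Prod.mk.injEq] at h
      obtain ⟨rfl, h⟩ := h
      have hu : u = u' := by simpa using congrFun h p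
      have hx : x = x' := by
        funext j
        by_cases hj : j = p
        · subst hj
          rw [hz.2.2.1, hz'.2.2.1]
        · simpa [Function.update_of_ne hj] using congrFun h j
      rw [hu, hx]
  have hfew : ∑ p ∈ Pᶜ, (B.filter (fun x => x p = v ∧ ¬ d < occCount n N x v)).card ≤
      d * B.card := by
    simp only [Finset.card_filter]
    rw [Finset.sum_comm, mul_comm, ← smul_eq_mul]
    refine Finset.sum_le_card_nsmul _ _ _ fun x _ => ?_
    rw [← Finset.card_filter]
    by_cases ho : d < occCount n N x v
    · simp [ho]
    · refine le_trans (Finset.card_le_card fun p hp => ?_) (not_lt.mp ho)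
      simp only [Finset.mem_filter, Finset.mem_univ, true_and] at hp ⊢
      exact hp.2.1
  rw [Finset.sum_congr rfl hsplit, Finset.sum_add_distrib]
  nlinarith [Nat.mul_le_mul_left n hfew]

lemma card_minOccOn_insert_le_card_insert {n N d : ℕ} {P : Finset (Fin N)} {S : Finset (Fin n)}
    {p q : Fin N} (hp : p ∉ P) (hq : q ∉ P) :
    (minOccOn n N d (insert p P) S).card ≤ (minOccOn n N d (insert q P) S).card := by
  refine Finset.card_le_card_of_injOn (fun x => x ∘ Equiv.swap p q) ?_ ?_
  · intro x hx
    simp only [Finset.mem_coe, mem_minOccOn] at hx ⊢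
    refine ⟨fun v => by rw [occCount_comp_equiv]; exact hx.1 v, fun j hj => ?_⟩
    rw [Finset.mem_insert] at hj
    rcases hj with rfl | hj
    · simpa using hx.2 p (Finset.mem_insert_self _ _)
    · have h1 : j ≠ p := by rintro rfl; exact hp hj
      have h2 : j ≠ q := by rintro rfl; exact hq hj
      simpa [Equiv.swap_apply_of_ne_of_ne h1 h2] using hx.2 j (Finset.mem_insert_of_mem hj)
  · exact fun x _ y _ h => (Equiv.surjective _).injective_comp_right h

lemma card_minOccOn_insert_le {n N d : ℕ} {P : Finset (Fin N)} (S : Finset (Fin n))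
    {p : Fin N} (hp : p ∉ P) :
    n * ((N - P.card) * (minOccOn n N d (insert p P) S).card) ≤
      S.card * (N + n * d) * (minOccOn n N d P S).card := by
  have h1 : (N - P.card) * (minOccOn n N d (insert p P) S).card ≤
      ∑ q ∈ Pᶜ, (minOccOn n N d (insert q P) S).card := by
    have h := Finset.card_nsmul_le_sum Pᶜ (fun q => (minOccOn n N d (insert q P) S).card)
      (minOccOn n N d (insert p P) S).card
      (fun q hq => card_minOccOn_insert_le_card_insert hp (Finset.mem_compl.mp hq))
    simpa [Finset.card_compl] using h
  have h2 : ∀ q, (minOccOn n N d (insert q P) S).card =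
      ∑ v ∈ S, ((minOccOn n N d P S).filter (fun x => x q = v)).card := by
    intro q
    rw [Finset.card_eq_sum_card_fiberwise (f := fun x => x q) (t := S)]
    · refine Finset.sum_congr rfl fun v hv => congrArg _ ?_
      ext x
      simp only [Finset.mem_filter, mem_minOccOn, Finset.forall_mem_insert]
      constructor
      · rintro ⟨⟨h, _, h'⟩, h''⟩
        exact ⟨⟨h, h'⟩, h''⟩
      · rintro ⟨⟨h, h'⟩, h''⟩
        exact ⟨⟨h, h'' ▸ hv, h'⟩, h''⟩
    · intro x hx
      exact (mem_minOccOn.mp hx).2 q (Finset.mem_insert_self _ _)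
  calc n * ((N - P.card) * (minOccOn n N d (insert p P) S).card)
      ≤ n * ∑ q ∈ Pᶜ, (minOccOn n N d (insert q P) S).card := Nat.mul_le_mul_left _ h1
    _ = ∑ v ∈ S, n * ∑ q ∈ Pᶜ, ((minOccOn n N d P S).filter (fun x => x q = v)).card := by
        simp only [h2]
        rw [Finset.sum_comm, Finset.mul_sum]
    _ ≤ ∑ _v ∈ S, (N + n * d) * (minOccOn n N d P S).card :=
        Finset.sum_le_sum fun v _ => sum_card_minOccOn_eq_le n N d P S v
    _ = S.card * (N + n * d) * (minOccOn n N d P S).card := by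
        rw [Finset.sum_const, smul_eq_mul, mul_assoc]

lemma descFactorial_mul_card_minOccOn_le {n N d : ℕ} (P : Finset (Fin N)) (S : Finset (Fin n)) :
    n ^ P.card * (N.descFactorial P.card * (minOccOn n N d P S).card) ≤
      (S.card * (N + n * d)) ^ P.card * (minOccOn n N d ∅ S).card := by
  induction P using Finset.induction_on with
  | empty => simp
  | insert p P hp ih =>
    rw [Finset.card_insert_of_notMem hp, Nat.descFactorial_succ]
    calc n ^ (P.card + 1) * ((N - P.card) * N.descFactorial P.card *
          (minOccOn n N d (insert p P) S).card)
        = n ^ P.card * N.descFactorial P.card *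
          (n * ((N - P.card) * (minOccOn n N d (insert p P) S).card)) := by ring
      _ ≤ n ^ P.card * N.descFactorial P.card *
          (S.card * (N + n * d) * (minOccOn n N d P S).card) :=
          Nat.mul_le_mul_left _ (card_minOccOn_insert_le S hp)
      _ = S.card * (N + n * d) *
          (n ^ P.card * (N.descFactorial P.card * (minOccOn n N d P S).card)) := by ring
      _ ≤ S.card * (N + n * d) *
          ((S.card * (N + n * d)) ^ P.card * (minOccOn n N d ∅ S).card) :=
          Nat.mul_le_mul_left _ ih
      _ = _ := by ring

/-- The sequences with minimum degree at least `d` for which some `s`-set spans at least `t`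
edges. -/
noncomputable def denseSeqs (n M d s t : ℕ) : Finset (Fin (2 * M) → Fin n) :=
  Finset.univ.filter (fun x => (∀ v, d ≤ occCount n (2 * M) x v) ∧
    ∃ S : Finset (Fin n), S.card = s ∧ t ≤ spanCount n M x S)

/-- The positions of the endpoints of the edges in `J`. -/
noncomputable def endpointPositions {M : ℕ} (J : Finset (Fin M)) : Finset (Fin (2 * M)) :=
  (J ×ˢ (Finset.univ : Finset (Fin 2))).image
    (fun z => ⟨2 * (z.1 : ℕ) + (z.2 : ℕ), by have := z.1.2; have := z.2.2; omega⟩)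

lemma card_endpointPositions {M : ℕ} (J : Finset (Fin M)) :
    (endpointPositions J).card = 2 * J.card := by
  unfold endpointPositions
  rw [Finset.card_image_of_injective]
  · simp [mul_comm]
  · rintro ⟨a, b⟩ ⟨a', b'⟩ h
    simp only [Fin.mk.injEq] at h
    have := b.2
    have := b'.2
    ext <;> simp only <;> omega

lemma descFactorial_mul_card_denseSeqs_le (n M d s t : ℕ) :
    n ^ (2 * t) * ((2 * M).descFactorial (2 * t) * (denseSeqs n M d s t).card) ≤
      n.choose s * M.choose t *
        ((s * (2 * M + n * d)) ^ (2 * t) * (minOccOn n (2 * M) d ∅ ∅).card) := by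
  have hsub : denseSeqs n M d s t ⊆
      (Finset.powersetCard s (Finset.univ : Finset (Fin n)) ×ˢ
        Finset.powersetCard t (Finset.univ : Finset (Fin M))).biUnion
        (fun z => minOccOn n (2 * M) d (endpointPositions z.2) z.1) := by
    intro x hx
    simp only [denseSeqs, Finset.mem_filter, Finset.mem_univ, true_and] at hx
    obtain ⟨hd, S, hS, ht⟩ := hx
    obtain ⟨J, hJ, hJt⟩ := Finset.exists_subset_card_eq ht
    simp only [Finset.mem_biUnion, Finset.mem_product, Finset.mem_powersetCard,
      Finset.subset_univ, true_and, mem_minOccOn]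
    refine ⟨(S, J), ⟨hS, hJt⟩, hd, fun p hp => ?_⟩
    simp only [endpointPositions, Finset.mem_image, Finset.mem_product, Finset.mem_univ,
      and_true] at hp
    obtain ⟨⟨j, b⟩, hj, rfl⟩ := hp
    have h := (Finset.mem_filter.mp (hJ hj)).2
    fin_cases b
    · exact h.1
    · exact h.2
  have hcard := (Finset.card_le_card hsub).trans Finset.card_biUnion_le
  have hempty : ∀ S : Finset (Fin n),
      minOccOn n (2 * M) d ∅ S = minOccOn n (2 * M) d ∅ ∅ := by
    intro S; simp [minOccOn]
  calc n ^ (2 * t) * ((2 * M).descFactorial (2 * t) * (denseSeqs n M d s t).card)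
      ≤ n ^ (2 * t) * ((2 * M).descFactorial (2 * t) *
        ∑ z ∈ Finset.powersetCard s (Finset.univ : Finset (Fin n)) ×ˢ
          Finset.powersetCard t (Finset.univ : Finset (Fin M)),
          (minOccOn n (2 * M) d (endpointPositions z.2) z.1).card) := by gcongr
    _ = ∑ z ∈ Finset.powersetCard s (Finset.univ : Finset (Fin n)) ×ˢ
          Finset.powersetCard t (Finset.univ : Finset (Fin M)),
          n ^ (2 * t) * ((2 * M).descFactorial (2 * t) *
          (minOccOn n (2 * M) d (endpointPositions z.2) z.1).card) := by
        simp only [Finset.mul_sum]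
    _ ≤ ∑ _z ∈ Finset.powersetCard s (Finset.univ : Finset (Fin n)) ×ˢ
          Finset.powersetCard t (Finset.univ : Finset (Fin M)),
          (s * (2 * M + n * d)) ^ (2 * t) * (minOccOn n (2 * M) d ∅ ∅).card := by
        refine Finset.sum_le_sum fun z hz => ?_
        simp only [Finset.mem_product, Finset.mem_powersetCard] at hz
        have h := descFactorial_mul_card_minOccOn_le (d := d) (endpointPositions z.2) z.1
        rwa [card_endpointPositions, hz.1.2, hz.2.2, hempty] at h
    _ = _ := by simp

lemma sq_descFactorial_le_descFactorial_two_mul (M t : ℕ) :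
    M.descFactorial t ^ 2 ≤ (2 * M).descFactorial (2 * t) := by
  induction t with
  | zero => simp
  | succ t ih =>
    rw [Nat.descFactorial_succ, show 2 * (t + 1) = 2 * t + 1 + 1 by ring,
      Nat.descFactorial_succ, Nat.descFactorial_succ]
    calc ((M - t) * M.descFactorial t) ^ 2
        = (M - t) * ((M - t) * M.descFactorial t ^ 2) := by ring
      _ ≤ _ := Nat.mul_le_mul (by omega) (Nat.mul_le_mul (by omega) ih)

lemma pow_mul_factorial_le {M t : ℕ} (h : t ≤ M) :
    M ^ t * t.factorial ≤ M.descFactorial t * t ^ t := by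
  calc M ^ t * t.factorial = ∏ i ∈ Finset.range t, M * (t - i) := by
        rw [← Nat.descFactorial_self t, Nat.descFactorial_eq_prod_range]
        simp [Finset.prod_mul_distrib]
    _ ≤ ∏ i ∈ Finset.range t, (M - i) * t := by
        refine Finset.prod_le_prod' fun i _ => ?_
        rw [Nat.mul_sub, Nat.sub_mul, mul_comm i t]
        exact Nat.sub_le_sub_left (Nat.mul_le_mul_right i h) _
    _ = M.descFactorial t * t ^ t := by
        rw [Nat.descFactorial_eq_prod_range]
        simp [Finset.prod_mul_distrib]

lemma self_pow_le_exp_mul_factorial (t : ℕ) :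
    (t : ℝ) ^ t ≤ Real.exp 1 ^ t * t.factorial := by
  have h := Real.pow_div_factorial_le_exp (t : ℝ) (by positivity) t
  rw [div_le_iff₀ (by positivity)] at h
  rwa [← Real.exp_nat_mul, mul_one]

lemma card_denseSeqs_mul_pow_le {n M d s a : ℕ} {K : ℝ} (hn : 1 ≤ n) (hnM : n ≤ M)
    (hs : 1 ≤ s) (has : a ≤ s) (hK : 1 ≤ K) (hKM : (2 * M + n * d : ℝ) ≤ K * n) :
    ((denseSeqs n M d s (s + a)).card : ℝ) * n ^ a ≤
      (Real.exp 1 ^ 5 * K ^ 4) ^ s * s ^ a * (minOccOn n (2 * M) d ∅ ∅).card := by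
  set b : ℝ := ((denseSeqs n M d s (s + a)).card : ℝ) with hb
  set A : ℝ := ((minOccOn n (2 * M) d ∅ ∅).card : ℝ) with hA
  set e : ℝ := Real.exp 1 with he
  have he1 : 1 ≤ e := Real.one_le_exp zero_le_one
  have hb0 : 0 ≤ b := Nat.cast_nonneg _
  have hA0 : 0 ≤ A := Nat.cast_nonneg _
  have hn0 : (0 : ℝ) < n := by exact_mod_cast hn
  have hs0 : (0 : ℝ) < s := by exact_mod_cast hs
  have hnM' : (n : ℝ) ≤ M := by exact_mod_cast hnM
  have hmain := descFactorial_mul_card_denseSeqs_le n M d s (s + a)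
  obtain ⟨t, ht⟩ : ∃ t, t = s + a := ⟨_, rfl⟩
  rw [← ht] at hmain
  have hst : (s : ℝ) ≤ t := by exact_mod_cast (by omega : s ≤ t)
  have ht0 : (0 : ℝ) < t := hs0.trans_le hst
  rcases le_or_gt t M with htM | htM
  swap
  · have hz : (denseSeqs n M d s (s + a)).card = 0 := by
      rw [Finset.card_eq_zero, denseSeqs, Finset.filter_eq_empty_iff]
      rintro x - ⟨-, S, -, hS⟩
      have := hS.trans (Finset.card_filter_le _ _)
      rw [Finset.card_univ, Fintype.card_fin] at this
      omega
    rw [hb, hz]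
    simp only [Nat.cast_zero, zero_mul]
    positivity
  have hF : (0 : ℝ) < M.descFactorial t := by
    exact_mod_cast Nat.descFactorial_pos.mpr htM
  set F : ℝ := (M.descFactorial t : ℝ) with hFdef
  set f : ℝ := (t.factorial : ℝ) with hfdef
  have hf : 0 < f := by positivity
  have hchoose : F = f * M.choose t := by
    rw [hFdef, hfdef]
    exact_mod_cast Nat.descFactorial_eq_factorial_mul_choose M t
  have h1 : F * f * b ≤ n.choose s * (s * K) ^ (2 * t) * A := by
    have hD : F ^ 2 ≤ ((2 * M).descFactorial (2 * t) : ℝ) := by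
      rw [hFdef]
      exact_mod_cast sq_descFactorial_le_descFactorial_two_mul M t
    have hcast : (n : ℝ) ^ (2 * t) * (((2 * M).descFactorial (2 * t) : ℝ) * b) ≤
        n.choose s * M.choose t * ((s * (2 * M + n * d : ℝ)) ^ (2 * t) * A) := by
      rw [hb, hA, ht]
      rw [ht] at hmain
      exact_mod_cast hmain
    have h : (n : ℝ) ^ (2 * t) * (F ^ 2 * b) ≤
        n.choose s * M.choose t * ((s * (K * n)) ^ (2 * t) * A) :=
      calc (n : ℝ) ^ (2 * t) * (F ^ 2 * b)
          ≤ n ^ (2 * t) * (((2 * M).descFactorial (2 * t) : ℝ) * b) := by gcongr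
        _ ≤ _ := hcast
        _ ≤ _ := by gcongr
    refine le_of_mul_le_mul_left ?_ (by positivity : 0 < (n : ℝ) ^ (2 * t) * F)
    calc (n : ℝ) ^ (2 * t) * F * (F * f * b) = f * (n ^ (2 * t) * (F ^ 2 * b)) := by ring
      _ ≤ f * (n.choose s * M.choose t * ((s * (K * n)) ^ (2 * t) * A)) := by gcongr
      _ = n ^ (2 * t) * F * (n.choose s * (s * K) ^ (2 * t) * A) := by
          rw [hchoose, ← mul_assoc (s : ℝ), mul_pow _ (n : ℝ)]; ring
  have h2 : (M : ℝ) ^ t * t ^ t ≤ e ^ (2 * t) * (F * f) := by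
    have hp : (M : ℝ) ^ t * f ≤ F * t ^ t := by
      rw [hFdef, hfdef]
      exact_mod_cast pow_mul_factorial_le htM
    have hq : (t : ℝ) ^ t ≤ e ^ t * f := self_pow_le_exp_mul_factorial t
    refine le_of_mul_le_mul_left ?_ (by positivity : 0 < (t : ℝ) ^ t)
    calc (t : ℝ) ^ t * (M ^ t * t ^ t) = M ^ t * (t ^ t * t ^ t) := by ring
      _ ≤ M ^ t * ((e ^ t * f) * (e ^ t * f)) := by gcongr
      _ = e ^ (2 * t) * f * (M ^ t * f) := by ring
      _ ≤ e ^ (2 * t) * f * (F * t ^ t) := by gcongr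
      _ = _ := by ring
  have h3 : (n.choose s : ℝ) * s ^ s ≤ e ^ s * n ^ s := by
    have hp : (s.factorial : ℝ) * n.choose s ≤ n ^ s := by
      rw [← Nat.cast_mul, ← Nat.descFactorial_eq_factorial_mul_choose]
      exact_mod_cast Nat.descFactorial_le_pow n s
    calc (n.choose s : ℝ) * s ^ s ≤ n.choose s * (e ^ s * s.factorial) := by
          gcongr
          exact self_pow_le_exp_mul_factorial s
      _ = e ^ s * (s.factorial * n.choose s) := by ring
      _ ≤ _ := by gcongr
  have h4 : (n : ℝ) ^ t * s ^ t * s ^ s * b ≤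
      e ^ (2 * t) * (s * K) ^ (2 * t) * (e ^ s * n ^ s) * A :=
    calc (n : ℝ) ^ t * s ^ t * s ^ s * b ≤ M ^ t * t ^ t * s ^ s * b := by gcongr
      _ ≤ e ^ (2 * t) * (F * f) * s ^ s * b := by gcongr
      _ = e ^ (2 * t) * s ^ s * (F * f * b) := by ring
      _ ≤ e ^ (2 * t) * s ^ s * (n.choose s * (s * K) ^ (2 * t) * A) := by gcongr
      _ = e ^ (2 * t) * (s * K) ^ (2 * t) * (n.choose s * s ^ s) * A := by ring
      _ ≤ _ := by gcongr
  have h5 : (e * K) ^ (2 * t) ≤ (e * K) ^ (4 * s) :=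
    pow_le_pow_right₀ (one_le_mul_of_one_le_of_one_le he1 hK) (by omega)
  refine le_of_mul_le_mul_left ?_ (by positivity : 0 < (n : ℝ) ^ s * s ^ (2 * s + a))
  calc (n : ℝ) ^ s * s ^ (2 * s + a) * (b * n ^ a) = n ^ t * s ^ t * s ^ s * b := by
        rw [ht]; ring
    _ ≤ e ^ (2 * t) * (s * K) ^ (2 * t) * (e ^ s * n ^ s) * A := h4
    _ = n ^ s * s ^ (2 * t) * ((e * K) ^ (2 * t) * e ^ s * A) := by ring
    _ ≤ n ^ s * s ^ (2 * t) * ((e * K) ^ (4 * s) * e ^ s * A) := by gcongr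
    _ = n ^ s * s ^ (2 * s + a) * ((e ^ 5 * K ^ 4) ^ s * s ^ a * A) := by
        rw [ht]; ring

lemma spanCount_empty (n M : ℕ) (x : Fin (2 * M) → Fin n) : spanCount n M x ∅ = 0 := by
  simp [spanCount]

lemma card_denseSeqs_succ_mul_le {n M d s κ : ℕ} {K : ℝ} (hn : 1 ≤ n) (hnM : n ≤ M)
    (hs : 1 ≤ s) (hsκ : s ≤ κ) (hK : 1 ≤ K) (hKM : (2 * M + n * d : ℝ) ≤ K * n) :
    ((denseSeqs n M d s (s + 1)).card : ℝ) * n ≤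
      (Real.exp 1 ^ 5 * K ^ 4) ^ κ * κ * (minOccOn n (2 * M) d ∅ ∅).card := by
  have h := card_denseSeqs_mul_pow_le (a := 1) hn hnM hs hs hK hKM
  rw [pow_one, pow_one] at h
  have hE : 1 ≤ Real.exp 1 ^ 5 * K ^ 4 :=
    one_le_mul_of_one_le_of_one_le (one_le_pow₀ (Real.one_le_exp zero_le_one))
      (one_le_pow₀ hK)
  refine h.trans ?_
  gcongr

lemma card_denseSeqs_mul_le_half_pow {n M d s a W : ℕ} {K : ℝ} (hn : 1 ≤ n) (hnM : n ≤ M)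
    (hs : 1 ≤ s) (ha : 1 ≤ a) (has : a ≤ s) (hK : 1 ≤ K)
    (hKM : (2 * M + n * d : ℝ) ≤ K * n) (hW : s ≤ W * (a - 1))
    (hsn : (s : ℝ) ≤ (1 / (4 * (Real.exp 1 ^ 5 * K ^ 4))) ^ W * n) :
    ((denseSeqs n M d s (s + a)).card : ℝ) * n ≤
      (1 / 2) ^ s * (minOccOn n (2 * M) d ∅ ∅).card := by
  have h := card_denseSeqs_mul_pow_le hn hnM hs has hK hKM
  have hE : 1 ≤ Real.exp 1 ^ 5 * K ^ 4 :=
    one_le_mul_of_one_le_of_one_le (one_le_pow₀ (Real.one_le_exp zero_le_one))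
      (one_le_pow₀ hK)
  set E := Real.exp 1 ^ 5 * K ^ 4
  set A : ℝ := ((minOccOn n (2 * M) d ∅ ∅).card : ℝ)
  set b : ℝ := ((denseSeqs n M d s (s + a)).card : ℝ)
  have hA : 0 ≤ A := Nat.cast_nonneg _
  have hn0 : (0 : ℝ) < n := by exact_mod_cast hn
  obtain ⟨c, rfl⟩ := Nat.exists_eq_add_of_le' ha
  rw [Nat.add_sub_cancel] at hW
  have hq : (1 / (4 * E)) ^ (W * c) ≤ (1 / (4 * E)) ^ s := by
    refine pow_le_pow_of_le_one (by positivity) ?_ hW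
    rw [div_le_one (by positivity)]
    linarith
  have hs2 : (s : ℝ) ≤ 2 ^ s := by exact_mod_cast Nat.lt_two_pow_self.le
  refine le_of_mul_le_mul_left ?_ (by positivity : 0 < (n : ℝ) ^ c)
  calc (n : ℝ) ^ c * (b * n) = b * n ^ (c + 1) := by ring
    _ ≤ E ^ s * s ^ (c + 1) * A := h
    _ = E ^ s * s * s ^ c * A := by ring
    _ ≤ E ^ s * 2 ^ s * ((1 / (4 * E)) ^ W * n) ^ c * A := by gcongr
    _ = n ^ c * (E ^ s * 2 ^ s * (1 / (4 * E)) ^ (W * c) * A) := by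
        rw [mul_pow, pow_mul]; ring
    _ ≤ n ^ c * (E ^ s * 2 ^ s * (1 / (4 * E)) ^ s * A) := by gcongr
    _ = n ^ c * ((1 / 2) ^ s * A) := by
        rw [← mul_pow, ← mul_pow]
        congr 3
        field_simp
        norm_num

lemma ceil_excess_bounds {s : ℕ} (hs : 2 * 10 ^ 10 ≤ s) :
    1 ≤ ⌈(1e-10 : ℝ) * s⌉₊ ∧ ⌈(1e-10 : ℝ) * s⌉₊ ≤ s ∧
      s ≤ 2 * 10 ^ 10 * (⌈(1e-10 : ℝ) * s⌉₊ - 1) := by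
  have hs' : (2 * 10 ^ 10 : ℝ) ≤ s := by exact_mod_cast hs
  have h1 := Nat.le_ceil ((1e-10 : ℝ) * s)
  have h2 : ⌈(1e-10 : ℝ) * s⌉₊ ≤ s := Nat.ceil_le.mpr (by linarith)
  generalize ⌈(1e-10 : ℝ) * s⌉₊ = a at *
  have h3 : s ≤ 10 ^ 10 * a := by
    have : (s : ℝ) ≤ 10 ^ 10 * a := by linarith
    exact_mod_cast this
  omega

/-- Fix `k ≥ 2` and constants `c₂ ≥ c₁ > (k+1)/2`, let `m = m(n)` satisfy
`c₁n ≤ m ≤ c₂n`, and let `G ~ G_{n,m}^{δ≥k+1,seq}`.  There is a constant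
`β = β(k,c₁,c₂) ∈ (0,1)` such that with probability `1 − O(n^{−1/2})`:
(i) no set `S` with `|S| ≤ k^400` spans at least `|S|+1` edges of `G`; and
(ii) no set `S` with `k^200 ≤ |S| ≤ βn` spans at least `(1+10^{−10})|S|` edges. -/
theorem stmt_9 (k : ℕ) (hk : 2 ≤ k) (c₁ c₂ : ℝ) (hc₁ : ((k : ℝ) + 1) / 2 < c₁)
    (hc₁₂ : c₁ ≤ c₂) (m : ℕ → ℕ)
    (hm : ∀ n : ℕ, c₁ * n ≤ (m n : ℝ) ∧ (m n : ℝ) ≤ c₂ * n) :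
    ∃ β : ℝ, 0 < β ∧ β < 1 ∧ ∃ C : ℝ, ∀ n : ℕ, 1 ≤ n →
      (Nat.card {x : Fin (2 * m n) → Fin n //
          (∀ v : Fin n, k + 1 ≤ occCount n (2 * m n) x v) ∧
          ((∃ S : Finset (Fin n), S.card ≤ k ^ 400 ∧
              S.card + 1 ≤ spanCount n (m n) x S) ∨
            (∃ S : Finset (Fin n), k ^ 200 ≤ S.card ∧ (S.card : ℝ) ≤ β * n ∧
              (1 + 1e-10) * (S.card : ℝ) ≤ (spanCount n (m n) x S : ℝ)))} : ℝ) /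
        (Nat.card {x : Fin (2 * m n) → Fin n //
          ∀ v : Fin n, k + 1 ≤ occCount n (2 * m n) x v} : ℝ) ≤
      C / Real.sqrt n := by
  have hk' : (2 : ℝ) ≤ k := by exact_mod_cast hk
  obtain ⟨W, hW⟩ : ∃ W : ℕ, W = 2 * 10 ^ 10 := ⟨_, rfl⟩
  have hl : 2 * 10 ^ 10 ≤ k ^ 200 :=
    calc 2 * 10 ^ 10 ≤ 2 ^ 35 := by norm_num
      _ ≤ k ^ 35 := Nat.pow_le_pow_left hk _
      _ ≤ k ^ 200 := Nat.pow_le_pow_right (by omega) (by norm_num)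
  generalize k ^ 200 = l at hl ⊢
  generalize k ^ 400 = κ
  set K : ℝ := 2 * c₂ + (k + 1) with hKdef
  have hK : 1 ≤ K := by linarith
  have hE : 1 ≤ Real.exp 1 ^ 5 * K ^ 4 :=
    one_le_mul_of_one_le_of_one_le (one_le_pow₀ (Real.one_le_exp zero_le_one))
      (one_le_pow₀ hK)
  set q : ℝ := 1 / (4 * (Real.exp 1 ^ 5 * K ^ 4)) with hq
  have hq1 : q < 1 := by
    rw [hq, div_lt_one (by positivity)]
    linarith
  have hq0 : 0 < q := by positivity
  refine ⟨q ^ W, by positivity, pow_lt_one₀ hq0.le hq1 (by omega),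
    κ * ((Real.exp 1 ^ 5 * K ^ 4) ^ κ * κ) + 2, fun n hn => ?_⟩
  have hn0 : (0 : ℝ) < n := by exact_mod_cast hn
  have hnM : n ≤ m n := by
    have : (n : ℝ) ≤ m n := by nlinarith [(hm n).1]
    exact_mod_cast this
  have hKM : (2 * m n + n * (k + 1 : ℕ) : ℝ) ≤ K * n := by
    push_cast
    nlinarith [(hm n).2]
  rw [Nat.card_eq_fintype_card, Nat.card_eq_fintype_card, Fintype.card_subtype,
    Fintype.card_subtype]
  have hA : Finset.univ.filter (fun x : Fin (2 * m n) → Fin n =>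
      ∀ v : Fin n, k + 1 ≤ occCount n (2 * m n) x v) = minOccOn n (2 * m n) (k + 1) ∅ ∅ := by
    simp [minOccOn]
  rw [hA]
  set A : ℝ := ((minOccOn n (2 * m n) (k + 1) ∅ ∅).card : ℝ) with hAdef
  have hA0 : 0 ≤ A := Nat.cast_nonneg _
  set large := (Finset.range (n + 1)).filter (fun s => l ≤ s ∧ (s : ℝ) ≤ q ^ W * n)
    with hlarge
  have hsub : Finset.univ.filter (fun x : Fin (2 * m n) → Fin n =>
      (∀ v : Fin n, k + 1 ≤ occCount n (2 * m n) x v) ∧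
          ((∃ S : Finset (Fin n), S.card ≤ κ ∧
              S.card + 1 ≤ spanCount n (m n) x S) ∨
            (∃ S : Finset (Fin n), l ≤ S.card ∧ (S.card : ℝ) ≤ q ^ W * n ∧
              (1 + 1e-10) * (S.card : ℝ) ≤ (spanCount n (m n) x S : ℝ)))) ⊆
      (Finset.Icc 1 κ).biUnion (fun s => denseSeqs n (m n) (k + 1) s (s + 1)) ∪
      large.biUnion
        (fun s => denseSeqs n (m n) (k + 1) s (s + ⌈(1e-10 : ℝ) * s⌉₊)) := by
    intro x hx
    simp only [Finset.mem_filter, Finset.mem_univ, true_and] at hx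
    obtain ⟨hd, ⟨S, hS, hspan⟩ | ⟨S, hS, hSn, hspan⟩⟩ := hx
    · refine Finset.mem_union_left _ (Finset.mem_biUnion.mpr ⟨S.card, ?_, ?_⟩)
      · refine Finset.mem_Icc.mpr ⟨Nat.one_le_iff_ne_zero.mpr fun h => ?_, hS⟩
        rw [Finset.card_eq_zero.mp h, spanCount_empty] at hspan
        omega
      · exact Finset.mem_filter.mpr ⟨Finset.mem_univ _, hd, S, rfl, hspan⟩
    · refine Finset.mem_union_right _ (Finset.mem_biUnion.mpr ⟨S.card, ?_, ?_⟩)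
      · have := Finset.card_le_univ S
        rw [Fintype.card_fin] at this
        exact Finset.mem_filter.mpr ⟨Finset.mem_range.mpr (by omega), hS, hSn⟩
      · refine Finset.mem_filter.mpr ⟨Finset.mem_univ _, hd, S, rfl, ?_⟩
        have h1 : (S.card : ℝ) ≤ spanCount n (m n) x S := by
          have : (0 : ℝ) ≤ S.card := Nat.cast_nonneg _
          linarith
        have h2 : S.card ≤ spanCount n (m n) x S := by exact_mod_cast h1
        have h3 : ⌈(1e-10 : ℝ) * S.card⌉₊ ≤ spanCount n (m n) x S - S.card := by
          rw [Nat.ceil_le, Nat.cast_sub h2]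
          linarith
        omega
  have hcard : ∀ b : ℕ, b ≤
      ∑ s ∈ Finset.Icc 1 κ, (denseSeqs n (m n) (k + 1) s (s + 1)).card +
      ∑ s ∈ large, (denseSeqs n (m n) (k + 1) s (s + ⌈(1e-10 : ℝ) * s⌉₊)).card →
      (b : ℝ) * n ≤ (κ * ((Real.exp 1 ^ 5 * K ^ 4) ^ κ * κ) + 2) * A := by
    intro b hb
    have hb' : (b : ℝ) ≤
        ∑ s ∈ Finset.Icc 1 κ, ((denseSeqs n (m n) (k + 1) s (s + 1)).card : ℝ) +
        ∑ s ∈ large, ((denseSeqs n (m n) (k + 1) s (s + ⌈(1e-10 : ℝ) * s⌉₊)).card : ℝ) := by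
      exact_mod_cast hb
    have hsmall : ∑ s ∈ Finset.Icc 1 κ,
        ((denseSeqs n (m n) (k + 1) s (s + 1)).card : ℝ) * n ≤
        κ * ((Real.exp 1 ^ 5 * K ^ 4) ^ κ * κ * A) := by
      have h := Finset.sum_le_card_nsmul (Finset.Icc 1 κ)
        (fun s => ((denseSeqs n (m n) (k + 1) s (s + 1)).card : ℝ) * n)
        ((Real.exp 1 ^ 5 * K ^ 4) ^ κ * κ * A) fun s hs =>
          card_denseSeqs_succ_mul_le hn hnM (Finset.mem_Icc.mp hs).1 (Finset.mem_Icc.mp hs).2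
            hK hKM
      simpa using h
    have hbig : ∑ s ∈ large,
        ((denseSeqs n (m n) (k + 1) s (s + ⌈(1e-10 : ℝ) * s⌉₊)).card : ℝ) * n ≤ 2 * A :=
      calc ∑ s ∈ large,
            ((denseSeqs n (m n) (k + 1) s (s + ⌈(1e-10 : ℝ) * s⌉₊)).card : ℝ) * n
          ≤ ∑ s ∈ large, (1 / 2) ^ s * A := by
            refine Finset.sum_le_sum fun s hs => ?_
            obtain ⟨-, hls, hsn⟩ := Finset.mem_filter.mp hs
            obtain ⟨h1, h2, h3⟩ := ceil_excess_bounds (hl.trans hls)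
            rw [← hW] at h3
            exact card_denseSeqs_mul_le_half_pow hn hnM (by omega) h1 h2 hK hKM h3 hsn
        _ ≤ ∑ s ∈ Finset.range (n + 1), (1 / 2) ^ s * A :=
            Finset.sum_le_sum_of_subset_of_nonneg (Finset.filter_subset _ _)
              fun _ _ _ => by positivity
        _ ≤ 2 * A := by
            rw [← Finset.sum_mul]
            exact mul_le_mul_of_nonneg_right (sum_geometric_two_le _) hA0
    rw [← Finset.sum_mul] at hsmall hbig
    nlinarith [mul_le_mul_of_nonneg_right hb' hn0.le]
  have hbad := hcard _ ((Finset.card_le_card hsub).trans ((Finset.card_union_le _ _).trans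
    (add_le_add Finset.card_biUnion_le Finset.card_biUnion_le)))
  have hsqrt : Real.sqrt n ≤ n := by
    have h1 : (1 : ℝ) ≤ n := by exact_mod_cast hn
    rw [Real.sqrt_le_left hn0.le]
    nlinarith
  rcases hA0.eq_or_lt with hA00 | hA00
  · rw [← hA00, div_zero]
    positivity
  · rw [div_le_div_iff₀ hA00 (Real.sqrt_pos.mpr hn0)]
    exact (mul_le_mul_of_nonneg_left hsqrt (Nat.cast_nonneg _)).trans hbad
end

section
/- For every integer r ≥ 1 and every real x > 0, λ_{r−1}(x) ≤ λ_r(x); that is, the mean of a Poisson(x) random variable conditioned on being at least r is nondecreasing in r. -/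
open Filter Real

/-- `truncMean ℓ x` is the mean of a Poisson(x) random variable conditioned on
being at least `ℓ`, i.e. `λ_ℓ(x) = (∑_{i≥ℓ} i·x^i/i!)/(∑_{i≥ℓ} x^i/i!)`. -/
noncomputable def truncMean (ℓ : ℕ) (x : ℝ) : ℝ :=
  (∑' i : ℕ, if ℓ ≤ i then (i : ℝ) * x ^ i / (Nat.factorial i : ℝ) else 0) /
  (∑' i : ℕ, if ℓ ≤ i then x ^ i / (Nat.factorial i : ℝ) else 0)

theorem summable_ite_le {f : ℕ → ℝ} (hf : Summable f) (n : ℕ) :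
    Summable fun i => if n ≤ i then f i else 0 := by
  refine (hf.indicator (Set.Ici n)).congr fun i => ?_
  simp [Set.indicator_apply]

theorem tsum_ite_le_eq_add {f : ℕ → ℝ} (hf : Summable f) (n : ℕ) :
    (∑' i, if n ≤ i then f i else 0) = f n + ∑' i, if n + 1 ≤ i then f i else 0 := by
  rw [(summable_ite_le hf n).tsum_eq_add_tsum_ite n, if_pos le_rfl]
  congr 2
  ext i
  split_ifs <;> first | rfl | omega

theorem summable_nat_mul_pow_div_factorial (x : ℝ) :
    Summable fun i : ℕ => (i : ℝ) * x ^ i / (Nat.factorial i : ℝ) := by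
  rw [← summable_nat_add_iff 1]
  refine ((Real.summable_pow_div_factorial x).mul_left x).congr fun i => ?_
  rw [Nat.factorial_succ, pow_succ]
  push_cast
  field_simp

/-- For every integer `r ≥ 1` and real `x > 0`, `λ_{r−1}(x) ≤ λ_r(x)`. -/
theorem stmt_11 (r : ℕ) (hr : 1 ≤ r) (x : ℝ) (hx : 0 < x) :
    truncMean (r - 1) x ≤ truncMean r x := by
  obtain ⟨n, rfl⟩ : ∃ n, r = n + 1 := ⟨r - 1, by omega⟩
  have hs := Real.summable_pow_div_factorial x
  have hs' := summable_nat_mul_pow_div_factorial x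
  have hpos : ∀ i : ℕ, 0 < x ^ i / (Nat.factorial i : ℝ) := fun i => by positivity
  have hD : 0 < ∑' i : ℕ, if n + 1 ≤ i then x ^ i / (Nat.factorial i : ℝ) else 0 := by
    refine (summable_ite_le hs (n + 1)).tsum_pos (fun i => ?_) (n + 1) ?_
    · split_ifs
      exacts [(hpos i).le, le_rfl]
    · simpa using hpos (n + 1)
  have hN : (n : ℝ) * (∑' i : ℕ, if n + 1 ≤ i then x ^ i / (Nat.factorial i : ℝ) else 0) ≤
      ∑' i : ℕ, if n + 1 ≤ i then (i : ℝ) * x ^ i / (Nat.factorial i : ℝ) else 0 := by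
    rw [← tsum_mul_left]
    refine ((summable_ite_le hs (n + 1)).mul_left _).tsum_le_tsum (fun i => ?_)
      (summable_ite_le hs' (n + 1))
    split_ifs with h
    · rw [mul_div_assoc]
      exact mul_le_mul_of_nonneg_right (by exact_mod_cast (by omega : n ≤ i)) (hpos i).le
    · simp
  rw [Nat.add_sub_cancel, truncMean, truncMean, tsum_ite_le_eq_add hs n,
    tsum_ite_le_eq_add hs' n, div_le_div_iff₀ (add_pos (hpos n) hD) hD, mul_div_assoc]
  nlinarith [mul_le_mul_of_nonneg_left hN (hpos n).le]
end

section
/- For every integer r ≥ 2, every real λ > 0 and every real a ≥ 3/2, a·λ_{r+1}(λ) − (a+1)·λ_r(λ) + λ_{r−1}(λ) ≥ 0. In particular, since the paper's constants a_r satisfy a_r ≥ 1.55, the function g(r,λ) := a_r·λ_{r+1}(λ) − (a_r+1)·λ_r(λ) + λ_{r−1}(λ) is nonnegative for all r ≥ 2 and λ > 0. -/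
open Filter Real

/-- The tail `∑_{i ≥ n} x ^ i / i!` of the exponential series. -/
noncomputable def expTail (x : ℝ) (n : ℕ) : ℝ :=
  ∑' k : ℕ, x ^ (k + n) / (Nat.factorial (k + n) : ℝ)

/-- The sum `∑_{i > n} (i - (n + 1)) * x ^ i / i!`, in closed form. -/
noncomputable def expTailMoment (x : ℝ) (n : ℕ) : ℝ :=
  x * expTail x n - (n + 1) * expTail x (n + 1)

section Sequences

lemma nonneg_of_succ_le_of_tendsto_zero {D : ℕ → ℝ} {n : ℕ}
    (hD : ∀ m, n ≤ m → D (m + 1) ≤ D m) (h0 : Tendsto D atTop (nhds 0)) : 0 ≤ D n := by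
  have h : Antitone fun k => D (k + n) := antitone_nat_of_succ_le fun k => by
    have := hD (k + n) (by omega)
    rwa [add_right_comm] at this
  simpa using h.le_of_tendsto ((tendsto_add_atTop_iff_nat n).2 h0) 0

lemma mul_succ_le_of_succ_mul_le {a b : ℕ → ℝ} (hb : ∀ n, 0 < b n)
    (h : ∀ n, a (n + 1) * b n ≤ a n * b (n + 1)) {n m : ℕ} (hnm : n ≤ m) :
    a m * b n ≤ a n * b m := by
  have hanti : Antitone fun k => a k / b k :=
    antitone_nat_of_succ_le fun k => (div_le_div_iff₀ (hb _) (hb _)).2 (h k)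
  exact (div_le_div_iff₀ (hb _) (hb _)).1 (hanti hnm)

end Sequences

section ExpTail

variable {x : ℝ}

lemma summable_shifted_exp (x : ℝ) (n : ℕ) :
    Summable fun k : ℕ => x ^ (k + n) / (Nat.factorial (k + n) : ℝ) :=
  (summable_nat_add_iff n).2 (Real.summable_pow_div_factorial x)

lemma expTail_eq_add (x : ℝ) (n : ℕ) :
    expTail x n = x ^ n / (Nat.factorial n : ℝ) + expTail x (n + 1) := by
  unfold expTail
  rw [(summable_shifted_exp x n).tsum_eq_zero_add]
  simp only [zero_add, add_right_comm, add_assoc]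

lemma succ_mul_pow_succ_div_factorial (x : ℝ) (n : ℕ) :
    ((n : ℝ) + 1) * (x ^ (n + 1) / (Nat.factorial (n + 1) : ℝ)) =
      x * (x ^ n / (Nat.factorial n : ℝ)) := by
  have : (Nat.factorial n : ℝ) ≠ 0 := by positivity
  rw [Nat.factorial_succ]
  push_cast
  field_simp
  ring

lemma expTail_pos (hx : 0 < x) (n : ℕ) : 0 < expTail x n :=
  (summable_shifted_exp x n).tsum_pos (fun _ => by positivity) 0 (by positivity)

lemma tendsto_expTail (x : ℝ) : Tendsto (expTail x) atTop (nhds 0) :=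
  tendsto_sum_nat_add fun i => x ^ i / (Nat.factorial i : ℝ)

lemma succ_mul_expTail_succ_le (hx : 0 < x) (n : ℕ) :
    ((n : ℝ) + 1) * expTail x (n + 1) ≤ x * expTail x n := by
  unfold expTail
  rw [← tsum_mul_left, ← tsum_mul_left]
  refine Summable.tsum_le_tsum (fun k => ?_) ((summable_shifted_exp x _).mul_left _)
    ((summable_shifted_exp x _).mul_left _)
  rw [← succ_mul_pow_succ_div_factorial, ← add_assoc]
  push_cast
  gcongr
  linarith [(Nat.cast_nonneg k : (0 : ℝ) ≤ k)]

lemma expTailMoment_nonneg (hx : 0 < x) (n : ℕ) : 0 ≤ expTailMoment x n :=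
  sub_nonneg.2 (succ_mul_expTail_succ_le hx n)

lemma expTailMoment_eq_add (x : ℝ) (n : ℕ) :
    expTailMoment x n = expTailMoment x (n + 1) + expTail x (n + 2) := by
  have h := succ_mul_pow_succ_div_factorial x n
  have h0 := expTail_eq_add x n
  have h1 := expTail_eq_add x (n + 1)
  unfold expTailMoment
  push_cast
  linear_combination x * h0 - (n + 1) * h1 - h

lemma tendsto_natCast_mul_expTail (hx : 0 < x) :
    Tendsto (fun n : ℕ => (n : ℝ) * expTail x n) atTop (nhds 0) := by
  rw [← tendsto_add_atTop_iff_nat 1]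
  have h : Tendsto (fun n => x * expTail x n) atTop (nhds 0) := by
    simpa using (tendsto_expTail x).const_mul x
  refine squeeze_zero (fun n => ?_) (fun n => ?_) h
  · have := expTail_pos hx (n + 1)
    positivity
  · simpa using succ_mul_expTail_succ_le hx n

lemma expTailMoment_le (hx : 0 < x) (n : ℕ) : expTailMoment x n ≤ x * expTail x n := by
  have := expTail_pos hx (n + 1)
  exact sub_le_self _ (by positivity)

lemma tendsto_expTailMoment (hx : 0 < x) :
    Tendsto (expTailMoment x) atTop (nhds 0) := by
  refine squeeze_zero (expTailMoment_nonneg hx) (expTailMoment_le hx) ?_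
  simpa using (tendsto_expTail x).const_mul x

lemma tendsto_natCast_mul_expTailMoment (hx : 0 < x) :
    Tendsto (fun n : ℕ => (n : ℝ) * expTailMoment x n) atTop (nhds 0) := by
  refine squeeze_zero (g := fun n : ℕ => x * ((n : ℝ) * expTail x n)) (fun n => ?_) (fun n => ?_) ?_
  · have := expTailMoment_nonneg hx n
    positivity
  · have := mul_le_mul_of_nonneg_left (expTailMoment_le hx n) (Nat.cast_nonneg (α := ℝ) n)
    linarith
  · simpa using (tendsto_natCast_mul_expTail hx).const_mul x

lemma pow_div_factorial_ratio (hx : 0 < x) {n m : ℕ} (hnm : n ≤ m) :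
    x ^ (m + 1) / (Nat.factorial (m + 1) : ℝ) * (x ^ n / (Nat.factorial n : ℝ)) ≤
      x ^ (n + 1) / (Nat.factorial (n + 1) : ℝ) * (x ^ m / (Nat.factorial m : ℝ)) := by
  refine mul_succ_le_of_succ_mul_le (a := fun k => x ^ (k + 1) / (Nat.factorial (k + 1) : ℝ))
    (b := fun k => x ^ k / (Nat.factorial k : ℝ)) (fun k => by positivity) (fun k => ?_) hnm
  have h0 := succ_mul_pow_succ_div_factorial x k
  have h1 := succ_mul_pow_succ_div_factorial x (k + 1)
  have hp : 0 < x ^ k / (Nat.factorial k : ℝ) := by positivity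
  have hq : 0 < x ^ (k + 1) / (Nat.factorial (k + 1) : ℝ) := by positivity
  have hs : 0 < x ^ (k + 1 + 1) / (Nat.factorial (k + 1 + 1) : ℝ) := by positivity
  push_cast at h1
  generalize x ^ k / (Nat.factorial k : ℝ) = p at *
  generalize x ^ (k + 1) / (Nat.factorial (k + 1) : ℝ) = q at *
  generalize x ^ (k + 1 + 1) / (Nat.factorial (k + 1 + 1) : ℝ) = s at *
  refine le_of_mul_le_mul_left ?_ hx
  nlinarith [mul_pos hs hq]

lemma expTail_logConcave (hx : 0 < x) (n : ℕ) :
    expTail x (n + 2) * expTail x n ≤ expTail x (n + 1) * expTail x (n + 1) := by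
  set p : ℕ → ℝ := fun k => x ^ k / (Nat.factorial k : ℝ) with hp
  have key : 0 ≤ expTail x (n + 1) * p (n + 1) - expTail x (n + 1 + 1) * p n := by
    refine nonneg_of_succ_le_of_tendsto_zero
      (D := fun m => expTail x m * p (n + 1) - expTail x (m + 1) * p n) (fun m hm => ?_) ?_
    · have h0 := expTail_eq_add x m
      have h1 := expTail_eq_add x (m + 1)
      have h2 := pow_div_factorial_ratio hx (show n ≤ m by omega)
      simp only [hp]
      rw [h0, h1]
      linarith
    · have ht := tendsto_expTail x
      simpa using (ht.mul_const (p (n + 1))).sub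
        (((tendsto_add_atTop_iff_nat 1).2 ht).mul_const (p n))
  have h0 := expTail_eq_add x n
  have h1 := expTail_eq_add x (n + 1)
  simp only [hp, add_assoc, Nat.reduceAdd] at key h1
  linear_combination key + expTail x (n + 2) * h0 - expTail x (n + 1) * h1

lemma expTailMoment_ratio (hx : 0 < x) {n m : ℕ} (hnm : n ≤ m) :
    expTailMoment x m * expTail x (n + 1) ≤ expTailMoment x n * expTail x (m + 1) := by
  refine mul_succ_le_of_succ_mul_le (b := fun k => expTail x (k + 1))
    (fun k => expTail_pos hx _) (fun k => ?_) hnm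
  suffices h : 0 ≤ expTailMoment x k * expTail x (k + 2) -
      expTailMoment x (k + 1) * expTail x (k + 1) from sub_nonneg.1 h
  refine nonneg_of_succ_le_of_tendsto_zero
    (D := fun m => expTailMoment x m * expTail x (k + 2) -
      expTailMoment x (m + 1) * expTail x (k + 1)) (fun m hm => ?_) ?_
  · have h0 := expTailMoment_eq_add x m
    have h1 := expTailMoment_eq_add x (m + 1)
    have h2 := mul_succ_le_of_succ_mul_le (a := fun k => expTail x (k + 1)) (b := expTail x)
      (expTail_pos hx) (expTail_logConcave hx) (show k + 1 ≤ m + 2 by omega)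
    rw [h0, h1]
    simp only [add_assoc, Nat.reduceAdd] at h2 ⊢
    linarith
  · have ht := tendsto_expTailMoment hx
    simpa using (ht.mul_const (expTail x (k + 2))).sub
      (((tendsto_add_atTop_iff_nat 1).2 ht).mul_const (expTail x (k + 1)))

/-- For the excess `Y = X - (n + 1)` of a Poisson variable conditioned on `X ≥ n + 1`, this says
`E[Y (Y - 1)] ≤ 2 E[Y] ^ 2`, the left side being expressed through `E[Y]` by summation by parts. -/
lemma secondMoment_le (hx : 0 < x) (n : ℕ) :
    ((x - n - 2) * expTailMoment x n + x * expTail x (n + 1)) * expTail x (n + 1) ≤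
      2 * expTailMoment x n ^ 2 := by
  suffices h : 0 ≤ 2 * expTailMoment x n * expTailMoment x n -
      ((x - n - 2) * expTailMoment x n + x * expTail x (n + 1)) * expTail x (n + 1) by linarith
  refine nonneg_of_succ_le_of_tendsto_zero
    (D := fun m : ℕ => 2 * expTailMoment x n * expTailMoment x m -
      ((x - m - 2) * expTailMoment x m + x * expTail x (m + 1)) * expTail x (n + 1))
    (fun m hm => ?_) ?_
  · have h0 := expTailMoment_eq_add x m
    have h2 := expTailMoment_ratio hx (show n ≤ m + 1 by omega)
    have h3 : (x - m - 2) * expTailMoment x m + x * expTail x (m + 1) =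
        ((x - (m + 1) - 2) * expTailMoment x (m + 1) + x * expTail x (m + 2)) +
          2 * expTailMoment x (m + 1) := by
      have h4 : expTailMoment x (m + 1) =
          x * expTail x (m + 1) - (m + 2) * expTail x (m + 2) := by
        unfold expTailMoment
        push_cast
        ring
      linear_combination (x - m - 2) * h0 - h4
    push_cast
    rw [h3, h0]
    simp only [add_assoc, Nat.reduceAdd] at h2 ⊢
    linarith
  · have hW := tendsto_expTailMoment hx
    have hN := tendsto_natCast_mul_expTailMoment hx
    have hT := (tendsto_add_atTop_iff_nat 1).2 (tendsto_expTail x)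
    have h := (hW.const_mul (2 * expTailMoment x n)).sub
      ((((hW.const_mul (x - 2)).sub hN).add (hT.const_mul x)).mul_const (expTail x (n + 1)))
    simp only [mul_zero, sub_zero, add_zero, zero_mul] at h
    refine h.congr fun m => ?_
    ring

end ExpTail

section TruncMean

variable {x : ℝ}

lemma tsum_ite_le_eq {f : ℕ → ℝ} (n : ℕ) (hf : Summable fun k => f (k + n)) :
    ∑' i : ℕ, (if n ≤ i then f i else 0) = ∑' k : ℕ, f (k + n) := by
  have hs : Summable fun i => if n ≤ i then f i else 0 :=
    (summable_nat_add_iff n).1 (by simpa using hf)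
  rw [← hs.sum_add_tsum_nat_add n, Finset.sum_eq_zero]
  · simp
  · intro i hi
    exact if_neg (by simpa using hi)

lemma truncMean_succ (x : ℝ) (n : ℕ) :
    truncMean (n + 1) x = x * expTail x n / expTail x (n + 1) := by
  have hnum : ∀ k : ℕ, ((k + (n + 1) : ℕ) : ℝ) * x ^ (k + (n + 1)) /
      (Nat.factorial (k + (n + 1)) : ℝ) = x * (x ^ (k + n) / (Nat.factorial (k + n) : ℝ)) := by
    intro k
    rw [← succ_mul_pow_succ_div_factorial, ← add_assoc]
    push_cast
    ring
  unfold truncMean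
  rw [tsum_ite_le_eq (f := fun i => (i : ℝ) * x ^ i / (Nat.factorial i : ℝ)),
    tsum_ite_le_eq (f := fun i => x ^ i / (Nat.factorial i : ℝ))]
  · simp only [hnum, tsum_mul_left]
    rfl
  · exact summable_shifted_exp x _
  · simp only [hnum]
    exact (summable_shifted_exp x n).mul_left x

lemma succ_le_truncMean_succ (hx : 0 < x) (n : ℕ) : (n : ℝ) + 1 ≤ truncMean (n + 1) x := by
  rw [truncMean_succ, le_div_iff₀ (expTail_pos hx _)]
  exact succ_mul_expTail_succ_le hx n

lemma le_truncMean_succ (hx : 0 < x) (n : ℕ) : x ≤ truncMean (n + 1) x := by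
  rw [truncMean_succ, le_div_iff₀ (expTail_pos hx _), expTail_eq_add x n]
  have : 0 < x ^ n / (Nat.factorial n : ℝ) := by positivity
  nlinarith

lemma truncMean_succ_mul_truncMean (hx : 0 < x) (n : ℕ) :
    truncMean (n + 1) x * truncMean (n + 2) x =
      (n + 1 + x) * truncMean (n + 2) x - (n + 1) * x := by
  have h1 := expTail_pos hx (n + 1)
  have h2 := expTail_pos hx (n + 2)
  rw [truncMean_succ, truncMean_succ x (n + 1)]
  field_simp
  have e0 := expTail_eq_add x n
  have e1 := expTail_eq_add x (n + 1)
  have h := succ_mul_pow_succ_div_factorial x n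
  simp only [add_assoc, Nat.reduceAdd] at e1 ⊢
  linear_combination x * e0 - (n + 1) * e1 - h

lemma truncMean_secondMoment_le (hx : 0 < x) (n : ℕ) :
    x * (truncMean (n + 1) x - n) ≤
      (truncMean (n + 1) x - n - 1) * (2 * truncMean (n + 1) x - n) := by
  have hT := expTail_pos hx (n + 1)
  have hA : expTailMoment x n = (truncMean (n + 1) x - n - 1) * expTail x (n + 1) := by
    rw [truncMean_succ]
    unfold expTailMoment
    field_simp
    ring
  have h := secondMoment_le hx n
  rw [hA] at h
  have h2 : ((x - n - 2) * (truncMean (n + 1) x - n - 1) + x) * expTail x (n + 1) ^ 2 ≤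
      (2 * (truncMean (n + 1) x - n - 1) ^ 2) * expTail x (n + 1) ^ 2 := by linarith
  have := le_of_mul_le_mul_right h2 (by positivity)
  linarith

lemma truncMean_le_succ (hx : 0 < x) (n : ℕ) : truncMean (n + 1) x ≤ truncMean (n + 2) x := by
  have hA := succ_le_truncMean_succ hx (n + 1)
  have hxA := le_truncMean_succ hx (n + 1)
  have hAB := truncMean_succ_mul_truncMean hx n
  simp only [add_assoc, Nat.reduceAdd] at hA hxA
  push_cast at hA
  have hpos : 0 < truncMean (n + 2) x := lt_of_lt_of_le (by positivity) hA
  refine le_of_mul_le_mul_right ?_ hpos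
  nlinarith [mul_nonneg (show 0 ≤ truncMean (n + 2) x - (n + 1) by linarith) (sub_nonneg.2 hxA)]

lemma three_halves_truncMean_nonneg (hx : 0 < x) (n : ℕ) :
    0 ≤ 3 * truncMean (n + 3) x - 5 * truncMean (n + 2) x + 2 * truncMean (n + 1) x := by
  have hA := succ_le_truncMean_succ hx (n + 2)
  have hB := succ_le_truncMean_succ hx (n + 1)
  have hxB := le_truncMean_succ hx (n + 1)
  have hAB := truncMean_succ_mul_truncMean hx (n + 1)
  have hBC := truncMean_succ_mul_truncMean hx n
  have hM := truncMean_secondMoment_le hx (n + 2)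
  simp only [add_assoc, Nat.reduceAdd] at hA hB hxB hAB hM
  push_cast at hA hB hAB hM
  generalize truncMean (n + 3) x = A at *
  generalize truncMean (n + 2) x = B at *
  generalize truncMean (n + 1) x = C at *
  obtain ⟨r, hr⟩ : ∃ r : ℝ, (n : ℝ) + 2 = r := ⟨_, rfl⟩
  obtain ⟨E, hE⟩ : ∃ E : ℝ, A - r = E := ⟨_, rfl⟩
  obtain rfl : A = r + E := by linarith
  have hn : (n : ℝ) = r - 2 := by linarith
  have hr2 : 2 ≤ r := by linarith [(Nat.cast_nonneg n : (0 : ℝ) ≤ n)]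
  rw [hn] at hA hB hAB hBC hM
  have hE1 : 1 ≤ E := by linarith
  have hB0 : 0 < B := by linarith
  have key : 0 ≤ 3 * (r + E) * B - 5 * r * B + 2 * r * (r - 1) := by
    have h : 0 ≤ (r + E) * (3 * (r + E) * B - 5 * r * B + 2 * r * (r - 1)) := by
      have h' : (r + E) * (3 * (r + E) * B - 5 * r * B + 2 * r * (r - 1)) =
          r * (r + E) * (3 * E - 2) - x * E * (2 * r - 3 * E) := by
        linear_combination (3 * E - 2 * r) * hAB
      rw [h']
      rcases le_total (2 * r) (3 * E) with hc | hc
      · have h1 : 0 ≤ r * (r + E) * (3 * E - 2) := by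
          apply mul_nonneg <;> [positivity; linarith]
        have h2 : 0 ≤ x * E * (3 * E - 2 * r) := by
          apply mul_nonneg <;> [positivity; linarith]
        linarith
      · have h1 := mul_le_mul_of_nonneg_right hM (sub_nonneg.2 hc)
        have h2 : 0 ≤ r * E * (r + E) := by positivity
        have h3 : 0 ≤ (E - 1) * (r * E + 6 * E ^ 2) :=
          mul_nonneg (by linarith) (by positivity)
        linarith
    exact nonneg_of_mul_nonneg_right h (by linarith)
  have hpos : 0 < r * B := by positivity
  refine nonneg_of_mul_nonneg_right (a := r * B) ?_ hpos
  have h := mul_nonneg (sub_nonneg.2 hxB) key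
  linear_combination h + 3 * B * hAB - 2 * r * hBC

end TruncMean

/-- For every integer `r ≥ 2`, real `λ > 0` and real `a ≥ 3/2`,
`a·λ_{r+1}(λ) − (a+1)·λ_r(λ) + λ_{r−1}(λ) ≥ 0`.  In particular this holds for any
constant `a ≥ 1.55` (such as the paper's constants `a_r`), so that
`g(r,λ) = a_r·λ_{r+1}(λ) − (a_r+1)·λ_r(λ) + λ_{r−1}(λ)` is nonnegative. -/
theorem stmt_13 (r : ℕ) (hr : 2 ≤ r) (l : ℝ) (hl : 0 < l) :
    (∀ a : ℝ, 3 / 2 ≤ a →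
      0 ≤ a * truncMean (r + 1) l - (a + 1) * truncMean r l + truncMean (r - 1) l) ∧
    (∀ a : ℝ, 1.55 ≤ a →
      0 ≤ a * truncMean (r + 1) l - (a + 1) * truncMean r l + truncMean (r - 1) l) := by
  obtain ⟨n, rfl⟩ := Nat.exists_eq_add_of_le' hr
  have main : ∀ a : ℝ, 3 / 2 ≤ a → 0 ≤ a * truncMean (n + 2 + 1) l -
      (a + 1) * truncMean (n + 2) l + truncMean (n + 2 - 1) l := by
    intro a ha
    have h1 := truncMean_le_succ hl (n + 1)
    have h2 := three_halves_truncMean_nonneg hl n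
    have h3 := mul_nonneg (sub_nonneg.2 ha) (sub_nonneg.2 h1)
    simp only [add_assoc, Nat.reduceAdd, Nat.add_sub_assoc, Nat.reduceSub,
      Nat.one_le_ofNat] at h3 ⊢
    linarith
  exact ⟨main, fun a ha => main a (by norm_num at ha ⊢; linarith)⟩
end

section
/- Let G be a simple graph, k ≥ 1 an integer, and M a k-matching of G of maximum size. Let v be a vertex with d_M(v) ≤ k − 1, and let Q_v be the set of all vertices reachable from v by an M-alternating path of even length starting with an edge not in M (so v ∈ Q_v). Then every vertex of N(Q_v) is joined to some vertex of Q_v by an edge of M; consequently |N(Q_v)| ≤ k·|Q_v|. -/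
open SimpleGraph

namespace SimpleGraph.Walk

variable {V : Type*} {G : SimpleGraph V}

/-- A walk is `M`-alternating if exactly its edges at odd indices (counted from zero)
belong to `M`. -/
def IsAlternating (M : Finset (Sym2 V)) {a b : V} (p : G.Walk a b) : Prop :=
  ∀ (i : ℕ) (hi : i < p.edges.length), (p.edges[i]'hi) ∈ M ↔ Odd i

theorem IsAlternating.take {M : Finset (Sym2 V)} {a b : V} {p : G.Walk a b}
    (hp : p.IsAlternating M) (n : ℕ) : (p.take n).IsAlternating M := by
  intro i hi
  have hi' : i < p.edges.length := by
    rw [edges_take, List.length_take] at hi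
    omega
  simpa [edges_take] using hp i hi'

theorem IsAlternating.concat {M : Finset (Sym2 V)} {a b c : V} {p : G.Walk a b}
    (hp : p.IsAlternating M) (h : G.Adj b c) (hM : s(b, c) ∈ M ↔ Odd p.length) :
    (p.concat h).IsAlternating M := by
  intro i hi
  simp only [edges_concat, List.concat_eq_append] at hi ⊢
  rw [List.getElem_append]
  split_ifs with hlt
  · exact hp i hlt
  · have : i = p.length := by
      simp at hi hlt
      omega
    simpa [this] using hM

theorem ite_eq_neg_one_pow {q : Prop} [Decidable q] {n : ℕ} (h : q ↔ Odd n) :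
    (if q then (-1 : ℤ) else 1) = (-1) ^ n := by
  split_ifs with hq
  · exact (h.1 hq).neg_one_pow.symm
  · exact (Nat.not_odd_iff_even.1 (mt h.2 hq)).neg_one_pow.symm

/-- The signs of the edges at a vertex telescope along a walk whose edges alternately leave
and enter `M`. -/
theorem sum_sign_incident [DecidableEq V] (M : Finset (Sym2 V)) (x : V) {a b : V}
    (p : G.Walk a b) (n : ℕ)
    (hp : ∀ (i : ℕ) (hi : i < p.edges.length), (p.edges[i]'hi) ∈ M ↔ Odd (i + n)) :
    (p.edges.map fun e => if x ∈ e then (if e ∈ M then (-1 : ℤ) else 1) else 0).sum =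
      (-1) ^ n * ((if x = a then 1 else 0) - (-1) ^ p.length * (if x = b then 1 else 0)) := by
  induction p generalizing n with
  | nil => simp
  | @cons a c b h p ih =>
    have h0 := hp 0 (by simp)
    have ih := ih (n + 1) fun i hi => by
      have := hp (i + 1) (by simpa using hi)
      simpa [add_assoc, add_comm 1 n] using this
    have hs : (if s(a, c) ∈ M then (-1 : ℤ) else 1) = (-1) ^ n :=
      ite_eq_neg_one_pow (by simpa using h0)
    have hi : (if x ∈ s(a, c) then (1 : ℤ) else 0) =
        (if x = a then 1 else 0) + (if x = c then 1 else 0) := by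
      have := h.ne
      grind
    have hm : (if x ∈ s(a, c) then (-1 : ℤ) ^ n else 0) =
        (-1) ^ n * (if x ∈ s(a, c) then 1 else 0) := by simp
    rw [edges_cons, List.map_cons, List.sum_cons, ih, hs, hm, hi, length_cons]
    ring

/-- The signs of all edges cancel in pairs along a walk whose edges alternately leave and
enter `M`. -/
theorem two_mul_sum_sign [DecidableEq V] (M : Finset (Sym2 V)) {a b : V}
    (p : G.Walk a b) (n : ℕ)
    (hp : ∀ (i : ℕ) (hi : i < p.edges.length), (p.edges[i]'hi) ∈ M ↔ Odd (i + n)) :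
    2 * (p.edges.map fun e => if e ∈ M then (-1 : ℤ) else 1).sum =
      (-1) ^ n * (1 - (-1) ^ p.length) := by
  induction p generalizing n with
  | nil => simp
  | @cons a c b h p ih =>
    have h0 := hp 0 (by simp)
    have ih := ih (n + 1) fun i hi => by
      have := hp (i + 1) (by simpa using hi)
      simpa [add_assoc, add_comm 1 n] using this
    have hs : (if s(a, c) ∈ M then (-1 : ℤ) else 1) = (-1) ^ n :=
      ite_eq_neg_one_pow (by simpa using h0)
    rw [edges_cons, List.map_cons, List.sum_cons, mul_add, ih, hs, length_cons]
    ring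

end SimpleGraph.Walk

theorem Finset.card_filter_symmDiff_toFinset {α : Type*} [Fintype α] [DecidableEq α]
    (M : Finset α) (l : List α) (hl : l.Nodup) (q : α → Prop) [DecidablePred q] :
    (((symmDiff M l.toFinset).filter q).card : ℤ) = (M.filter q).card +
      (l.map fun e => if q e then (if e ∈ M then (-1 : ℤ) else 1) else 0).sum := by
  have key (s : Finset α) (f : α → ℤ) : ∑ e ∈ s, f e = ∑ e, if e ∈ s then f e else 0 := by
    simp
  rw [← List.sum_toFinset _ hl, Finset.card_filter, Finset.card_filter, Nat.cast_sum,
    Nat.cast_sum, key (symmDiff M l.toFinset), key M, key l.toFinset, ← Finset.sum_add_distrib]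
  refine Finset.sum_congr rfl fun e _ => ?_
  by_cases h1 : e ∈ M <;> by_cases h2 : e ∈ l <;> by_cases h3 : q e <;>
    simp [Finset.mem_symmDiff, h1, h2, h3]

/-- Augmenting a `k`-matching along an odd alternating path between two distinct unsaturated
vertices yields a larger `k`-matching. -/
theorem SimpleGraph.Walk.IsAlternating.exists_larger {V : Type*} [Fintype V] [DecidableEq V]
    {G : SimpleGraph V} {k : ℕ} {M : Finset (Sym2 V)} (hME : ∀ e ∈ M, e ∈ G.edgeSet)
    (hMdeg : ∀ u : V, (M.filter (fun e => u ∈ e)).card ≤ k) {a b : V} {p : G.Walk a b}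
    (hp : p.IsAlternating M) (hpath : p.IsPath) (hodd : Odd p.length)
    (ha : (M.filter (fun e => a ∈ e)).card < k) (hb : (M.filter (fun e => b ∈ e)).card < k) :
    ∃ M' : Finset (Sym2 V), (∀ e ∈ M', e ∈ G.edgeSet) ∧
      (∀ u : V, (M'.filter (fun e => u ∈ e)).card ≤ k) ∧ M.card < M'.card := by
  have hnd : p.edges.Nodup := hpath.isTrail.edges_nodup
  have hab : a ≠ b := by
    rintro rfl
    simp [(SimpleGraph.Walk.isPath_iff_nil.1 hpath).eq_nil] at hodd
  refine ⟨symmDiff M p.edges.toFinset, fun e he => ?_, fun u => ?_, ?_⟩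
  · rcases Finset.mem_symmDiff.1 he with ⟨h, -⟩ | ⟨h, -⟩
    · exact hME e h
    · exact p.edges_subset_edgeSet (List.mem_toFinset.1 h)
  · have h1 := Finset.card_filter_symmDiff_toFinset M p.edges hnd (fun e => u ∈ e)
    rw [p.sum_sign_incident M u 0 hp, hodd.neg_one_pow] at h1
    have hu := hMdeg u
    by_cases hua : u = a
    · subst hua
      simp [hab] at h1
      omega
    · by_cases hub : u = b
      · subst hub
        simp [hua] at h1
        omega
      · simp [hua, hub] at h1
        omega
  · have h1 := Finset.card_filter_symmDiff_toFinset M p.edges hnd (fun _ => True)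
    have h2 := p.two_mul_sum_sign M 0 hp
    rw [hodd.neg_one_pow] at h2
    simp only [Finset.filter_true, if_true] at h1
    omega

/-- The number of vertices joined by `M` to a set `Q` is at most `k` times the size of `Q`. -/
theorem Set.ncard_le_mul_of_forall_exists_mem {V : Type*} [Fintype V] [DecidableEq V] {k : ℕ}
    {M : Finset (Sym2 V)} (hMdeg : ∀ u : V, (M.filter (fun e => u ∈ e)).card ≤ k)
    {Q N : Set V} (h : ∀ w ∈ N, ∃ u ∈ Q, s(u, w) ∈ M) : N.ncard ≤ k * Q.ncard := by
  classical
  rw [Set.ncard_eq_toFinset_card' N, Set.ncard_eq_toFinset_card' Q, mul_comm]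
  refine (Finset.card_le_card (t := Q.toFinset.biUnion fun u =>
    Finset.univ.filter fun w => s(u, w) ∈ M) fun w hw => ?_).trans
    (Finset.card_biUnion_le_card_mul _ _ _ fun u _ => ?_)
  · simpa using h w (by simpa using hw)
  · refine (Finset.card_le_card_of_injOn (fun w => s(u, w)) (fun w hw => ?_)
      fun x _ y _ hxy => Sym2.congr_right.1 hxy).trans (hMdeg u)
    simpa using hw

/-- Let `G` be a simple graph, `k ≥ 1`, and `M` a `k`-matching of `G` of maximum size
(a set of edges of `G` in which every vertex lies in at most `k` edges).  Let `v` be a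
vertex incident to at most `k − 1` edges of `M`, and let `Q` be the set of all vertices
reachable from `v` by an `M`-alternating path of even length starting with an edge not
in `M` (edges in odd positions are not in `M`, edges in even positions are in `M`).
Then every vertex of `N(Q)` is joined to some vertex of `Q` by an edge of `M`, and
consequently `|N(Q)| ≤ k·|Q|`. -/
theorem stmt_19 {V : Type*} [Fintype V] [DecidableEq V]
    (G : SimpleGraph V) (k : ℕ) (hk : 1 ≤ k)
    (M : Finset (Sym2 V))
    (hME : ∀ e ∈ M, e ∈ G.edgeSet)
    (hMdeg : ∀ u : V, (M.filter (fun e => u ∈ e)).card ≤ k)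
    (hMmax : ∀ M' : Finset (Sym2 V), (∀ e ∈ M', e ∈ G.edgeSet) →
      (∀ u : V, (M'.filter (fun e => u ∈ e)).card ≤ k) → M'.card ≤ M.card)
    (v : V) (hv : (M.filter (fun e => v ∈ e)).card ≤ k - 1) :
    ∀ Q NQ : Set V,
      Q = {u | ∃ p : G.Walk v u, p.IsPath ∧ Even p.length ∧
        ∀ (i : ℕ) (hi : i < p.edges.length), ((p.edges[i]'hi) ∈ M ↔ Odd i)} →
      NQ = {w | w ∉ Q ∧ ∃ u ∈ Q, G.Adj u w} →
      (∀ w ∈ NQ, ∃ u ∈ Q, s(u, w) ∈ M) ∧ NQ.ncard ≤ k * Q.ncard := by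
  rintro Q NQ hQ hNQ
  have hQ (u : V) :
      u ∈ Q ↔ ∃ p : G.Walk v u, p.IsPath ∧ Even p.length ∧ p.IsAlternating M := by
    rw [hQ]
    rfl
  suffices h : ∀ w ∈ NQ, ∃ u ∈ Q, s(u, w) ∈ M from
    ⟨h, Set.ncard_le_mul_of_forall_exists_mem hMdeg h⟩
  rw [hNQ]
  rintro w ⟨hwQ, u, huQ, huw⟩
  by_cases huwM : s(u, w) ∈ M
  · exact ⟨u, huQ, huwM⟩
  obtain ⟨p, hpath, heven, halt⟩ := (hQ u).1 huQ
  have hget {n : ℕ} (hn : n ≤ p.length) (he : Even n) : p.getVert n ∈ Q :=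
    (hQ _).2 ⟨p.take n, hpath.take n, by rwa [Walk.take_length, min_eq_left hn], halt.take n⟩
  by_cases hwp : w ∈ p.support
  · obtain ⟨n, rfl, hn⟩ := Walk.mem_support_iff_exists_getVert.1 hwp
    have hodd : Odd n := Nat.not_even_iff_odd.1 fun he => hwQ (hget hn he)
    have hlt : n < p.length := lt_of_le_of_ne hn (by rintro rfl; exact hwQ (hget hn heven))
    refine ⟨p.getVert (n + 1), hget hlt hodd.add_one, ?_⟩
    have := (halt n (by simpa using hlt)).2 hodd
    rwa [Walk.getElem_edges, Sym2.eq_swap] at this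
  have haltw := halt.concat huw (iff_of_false huwM (Nat.not_odd_iff_even.2 heven))
  have hpathw := hpath.concat hwp huw
  have hlenw : Odd (p.concat huw).length := by
    rw [Walk.length_concat]
    exact heven.add_one
  have hdeg : k ≤ (M.filter (fun e => w ∈ e)).card := by
    by_contra! hlt
    obtain ⟨M', hE, hdeg, hcard⟩ :=
      haltw.exists_larger hME hMdeg hpathw hlenw (by omega) hlt
    exact (hMmax M' hE hdeg).not_gt hcard
  obtain ⟨e, he⟩ := Finset.card_pos.1 (hk.trans hdeg)
  obtain ⟨heM, hwe⟩ := Finset.mem_filter.1 he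
  obtain ⟨x, rfl⟩ := Sym2.mem_iff_exists.1 hwe
  have hwx : G.Adj w x := hME _ heM
  refine ⟨x, ?_, by rwa [Sym2.eq_swap]⟩
  by_cases hxp : x ∈ p.support
  · obtain ⟨n, rfl, hn⟩ := Walk.mem_support_iff_exists_getVert.1 hxp
    by_contra hxQ
    have hodd : Odd n := Nat.not_even_iff_odd.1 fun he => hxQ (hget hn he)
    have hlen : (p.take n).length = n := by rw [Walk.take_length, min_eq_left hn]
    refine hwQ ((hQ w).2 ⟨(p.take n).concat hwx.symm, (hpath.take n).concat
      (fun h => hwp ((p.isSubwalk_take n).support_subset h)) hwx.symm, ?_,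
      (halt.take n).concat hwx.symm (iff_of_true (by rwa [Sym2.eq_swap]) (by rwa [hlen]))⟩)
    rw [Walk.length_concat, hlen]
    exact hodd.add_one
  · refine (hQ x).2 ⟨(p.concat huw).concat hwx, hpathw.concat ?_ hwx, ?_,
      haltw.concat hwx (iff_of_true heM hlenw)⟩
    · simpa [Walk.support_concat, hxp] using hwx.ne'
    · rw [Walk.length_concat]
      exact hlenw.add_one
end
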